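/- The outer and inner hulls coincide: for a matrix A ∈ 𝕋±^{d×n}, identifying A with its set of columns, tconv(A) equals the intersection of all open signed tropical halfspaces H⁺(v), v ∈ 𝕋±^{d+1}, that contain all columns of A. -/

import Mathlib

/-!  Signed tropical numbers 𝕋±, the symmetrized tropical semiring 𝕊,
     and signed tropical convexity (Loho–Végh). -/

inductive SSign : Type where
  | pos : SSign
  | neg : SSign
  | bal : SSign
deriving DecidableEq

/-- The symmetrized tropical semiring 𝕊: the tropical zero 𝟘 = -∞ together with
elements `elem s r` where `s` is a sign (⊕, ⊖ or •) and `r` a real number. -/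
inductive STrop : Type where
  | zero : STrop
  | elem : SSign → ℝ → STrop

namespace STrop

/-- membership in the signed tropical numbers 𝕋± (i.e. not balanced-nonzero). -/
def isSigned : STrop → Prop
  | elem SSign.bal _ => False
  | _ => True

/-- membership in 𝕋≥, the nonnegative tropical numbers. -/
def nneg : STrop → Prop
  | zero => True
  | elem SSign.pos _ => True
  | _ => False

/-- membership in 𝕋≤, the nonpositive tropical numbers. -/
def npos : STrop → Prop
  | zero => True
  | elem SSign.neg _ => True
  | _ => False

/-- strictly positive signed element (sign ⊕, not 𝟘). -/
def isPos : STrop → Prop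
  | elem SSign.pos _ => True
  | _ => False

/-- balanced or 𝟘 (membership in 𝕋•). -/
def balZero : STrop → Prop
  | zero => True
  | elem SSign.bal _ => True
  | _ => False

/-- the negation map ⊖. -/
def neg : STrop → STrop
  | zero => zero
  | elem SSign.pos r => elem SSign.neg r
  | elem SSign.neg r => elem SSign.pos r
  | elem SSign.bal r => elem SSign.bal r

/-- tropical addition ⊕ on 𝕊. -/
noncomputable def add : STrop → STrop → STrop
  | zero, y => y
  | x, zero => x
  | elem s r, elem t u =>
    if r < u then elem t u
    else if u < r then elem s r
    else if s = t then elem s r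
    else elem SSign.bal r

def signMul : SSign → SSign → SSign
  | SSign.pos, t => t
  | SSign.neg, SSign.pos => SSign.neg
  | SSign.neg, SSign.neg => SSign.pos
  | SSign.neg, SSign.bal => SSign.bal
  | SSign.bal, _ => SSign.bal

/-- tropical multiplication ⊙ on 𝕊. -/
def mul : STrop → STrop → STrop
  | zero, _ => zero
  | _, zero => zero
  | elem s r, elem t u => elem (signMul s t) (r + u)

/-- a ⊖ b := a ⊕ (⊖b). -/
noncomputable def sub (x y : STrop) : STrop := add x (neg y)

/-- the tropical one, the signed element ⊕0. -/
def one : STrop := elem SSign.pos 0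

/-- the absolute value |·| : 𝕊 → 𝕋≥. -/
def absS : STrop → STrop
  | zero => zero
  | elem _ r => elem SSign.pos r

/-- strict order: x > y iff x ⊖ y is a strictly positive signed element. -/
def sgt (x y : STrop) : Prop := isPos (sub x y)

/-- balance relation: x ⋈ y iff x ⊖ y is balanced or 𝟘. -/
def bal (x y : STrop) : Prop := balZero (sub x y)

/-- the relation ⊵ : x ⊵ y iff x > y or x ⋈ y. -/
def teq (x y : STrop) : Prop := sgt x y ∨ bal x y

/-- the total order ≤ on the signed tropical numbers 𝕋±
(arbitrarily `False` whenever a balanced element is involved). -/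
def sle : STrop → STrop → Prop
  | zero, zero => True
  | zero, elem SSign.pos _ => True
  | elem SSign.neg _, zero => True
  | elem SSign.neg _, elem SSign.pos _ => True
  | elem SSign.pos r, elem SSign.pos u => r ≤ u
  | elem SSign.neg r, elem SSign.neg u => u ≤ r
  | _, _ => False

/-- U(a): the set of signed numbers incomparable with a; the singleton {a}
for signed a, and the order interval [⊖|a|, |a|] for balanced a. -/
def U : STrop → Set STrop
  | elem SSign.bal r => {x | isSigned x ∧ sle (elem SSign.neg r) x ∧ sle x (elem SSign.pos r)}
  | a => {a}

/-- tropical sum of finitely many elements of 𝕊. -/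
noncomputable def sumFin : ∀ {n : ℕ}, (Fin n → STrop) → STrop
  | 0, _ => zero
  | _ + 1, f => add (f 0) (sumFin fun i => f i.succ)

/-- matrix–vector product A ⊙ x over 𝕊. -/
noncomputable def mv {d n : ℕ} (A : Fin d → Fin n → STrop) (x : Fin n → STrop) : Fin d → STrop :=
  fun i => sumFin fun j => mul (A i j) (x j)

/-- vectors in 𝕋±^d. -/
def isSignedVec {d : ℕ} (v : Fin d → STrop) : Prop := ∀ i, isSigned (v i)

/-- the signed tropical convex hull of the columns of a matrix A:
tconv(A) = {z ∈ 𝕋±^d : z ⋈ A⊙x for some x ∈ 𝕋≥^n with ⊕_j x_j = 0}. -/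
def tconv {d n : ℕ} (A : Fin d → Fin n → STrop) : Set (Fin d → STrop) :=
  {z | isSignedVec z ∧ ∃ x : Fin n → STrop,
    (∀ j, nneg (x j)) ∧ sumFin x = one ∧ ∀ i, bal (z i) (mv A x i)}

/-- the signed tropical convex hull of an arbitrary set: the union of the hulls
of all finite collections of points of M. -/
def tconvSet {d : ℕ} (M : Set (Fin d → STrop)) : Set (Fin d → STrop) :=
  ⋃ (n : ℕ) (A : Fin d → Fin n → STrop) (_ : ∀ j, (fun i => A i j) ∈ M), tconv A

/-- a set M ⊆ 𝕋±^d is tropically convex iff M = tconv(M). -/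
def TropConvex {d : ℕ} (M : Set (Fin d → STrop)) : Prop := M = tconvSet M

/-- evaluation a ⊙ (0, x₁, …, x_d)ᵀ of an affine functional. -/
noncomputable def affEval {d : ℕ} (a : Fin (d + 1) → STrop) (x : Fin d → STrop) : STrop :=
  sumFin fun j => mul (a j) ((Fin.cons one x : Fin (d + 1) → STrop) j)

/-- the open signed tropical halfspace H⁺(a) = {x ∈ 𝕋±^d : a⊙(0,x)ᵀ > 𝟘}. -/
def Hopen {d : ℕ} (a : Fin (d + 1) → STrop) : Set (Fin d → STrop) :=
  {x | isSignedVec x ∧ sgt (affEval a x) zero}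

/-- the closed signed tropical halfspace H̄⁺(a) = {x ∈ 𝕋±^d : a⊙(0,x)ᵀ ⊵ 𝟘}. -/
def Hclosed {d : ℕ} (a : Fin (d + 1) → STrop) : Set (Fin d → STrop) :=
  {x | isSignedVec x ∧ teq (affEval a x) zero}

/-- the non-negative kernel nnker(A). -/
def nnker {d n : ℕ} (A : Fin d → Fin n → STrop) : Set (Fin n → STrop) :=
  {x | (∀ j, nneg (x j)) ∧ x ≠ (fun _ => zero) ∧ ∀ i, balZero (mv A x i)}

/-- the open tropical cone sep(A) = {y ∈ 𝕋±^d : yᵀ⊙A > 𝟘 componentwise}. -/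
def sep {d : ℕ} {J : Type} (A : Fin d → J → STrop) : Set (Fin d → STrop) :=
  {y | isSignedVec y ∧ ∀ j, isPos (sumFin fun i => mul (y i) (A i j))}

end STrop

namespace STrop

lemma signMul_comm (s t : SSign) : signMul s t = signMul t s := by
  cases s <;> cases t <;> rfl

lemma signMul_assoc (s t w : SSign) : signMul (signMul s t) w = signMul s (signMul t w) := by
  cases s <;> cases t <;> cases w <;> rfl

lemma add_elem_of_lt {s t : SSign} {r u : ℝ} (h : r < u) :
    add (elem s r) (elem t u) = elem t u := by
  simp [add, h]

lemma add_elem_of_gt {s t : SSign} {r u : ℝ} (h : u < r) :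
    add (elem s r) (elem t u) = elem s r := by
  simp [add, h, h.le]

lemma add_elem_self (s t : SSign) (r : ℝ) :
    add (elem s r) (elem t r) = elem (if s = t then s else SSign.bal) r := by
  simp only [add, lt_irrefl, if_false]
  split_ifs <;> rfl

lemma add_zero' (x : STrop) : add x zero = x := by
  cases x <;> rfl

lemma add_comm' (x y : STrop) : add x y = add y x := by
  rcases x with _ | ⟨s, r⟩ <;> rcases y with _ | ⟨t, u⟩
  · rfl
  · rfl
  · rfl
  rcases lt_trichotomy r u with h | rfl | h
  · rw [add_elem_of_lt h, add_elem_of_gt h]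
  · rw [add_elem_self, add_elem_self]
    cases s <;> cases t <;> rfl
  · rw [add_elem_of_lt h, add_elem_of_gt h]

lemma add_assoc' (x y z : STrop) : add (add x y) z = add x (add y z) := by
  rcases x with _ | ⟨s, r⟩
  · rfl
  rcases y with _ | ⟨t, u⟩
  · rfl
  rcases z with _ | ⟨w, v⟩
  · simp only [add_zero']
  rcases lt_trichotomy r u with h | h | h <;> rcases lt_trichotomy u v with h' | h' | h'
  · simp only [add_elem_of_lt, h, h', h.trans h']
  · subst h'
    simp only [add_elem_of_lt h, add_elem_self]
  · simp only [add_elem_of_lt h, add_elem_of_gt h']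
  · subst h
    simp only [add_elem_of_lt h', add_elem_self]
  · subst h h'
    simp only [add_elem_self]
    cases s <;> cases t <;> cases w <;> rfl
  · subst h
    simp only [add_elem_of_gt h', add_elem_self]
  · rw [add_elem_of_gt h, add_elem_of_lt h']
  · subst h'
    simp only [add_elem_of_gt h, add_elem_self]
  · rw [add_elem_of_gt h, add_elem_of_gt h', add_elem_of_gt h, add_elem_of_gt (h'.trans h)]

lemma mul_add' (x y z : STrop) : mul x (add y z) = add (mul x y) (mul x z) := by
  rcases x with _ | ⟨s, r⟩
  · rfl
  rcases y with _ | ⟨t, u⟩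
  · rfl
  rcases z with _ | ⟨w, v⟩
  · rfl
  rcases lt_trichotomy u v with h | rfl | h
  · rw [add_elem_of_lt h]
    exact (add_elem_of_lt (by linarith)).symm
  · simp only [add_elem_self, mul]
    cases s <;> cases t <;> cases w <;> rfl
  · rw [add_elem_of_gt h]
    exact (add_elem_of_gt (by linarith)).symm

lemma mul_comm' (x y : STrop) : mul x y = mul y x := by
  rcases x with _ | ⟨s, r⟩ <;> rcases y with _ | ⟨t, u⟩ <;> simp only [mul]
  rw [signMul_comm, add_comm]

/-- The symmetrized tropical numbers form a commutative semiring. -/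
noncomputable instance : CommSemiring STrop where
  add := add
  zero := zero
  add_assoc := add_assoc'
  zero_add _ := rfl
  add_zero := add_zero'
  add_comm := add_comm'
  nsmul := @nsmulRec STrop ⟨zero⟩ ⟨add⟩
  mul := mul
  one := one
  mul_assoc x y z := by
    rcases x with _ | ⟨s, r⟩ <;> rcases y with _ | ⟨t, u⟩ <;> rcases z with _ | ⟨w, v⟩ <;> try rfl
    change elem _ _ = elem _ _
    rw [signMul_assoc, add_assoc]
  one_mul x := by
    rcases x with _ | ⟨s, r⟩
    · rfl
    change elem _ _ = elem _ _
    rw [zero_add]; rfl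
  mul_one x := by
    rcases x with _ | ⟨s, r⟩
    · rfl
    change elem _ _ = elem _ _
    rw [add_zero]; cases s <;> rfl
  mul_comm := mul_comm'
  zero_mul _ := rfl
  mul_zero x := by cases x <;> rfl
  left_distrib := mul_add'
  right_distrib x y z := by
    change mul (add x y) z = add (mul x z) (mul y z)
    rw [mul_comm', mul_add', mul_comm' x, mul_comm' y]

lemma zero_eq : zero = 0 := rfl

lemma one_eq : one = 1 := rfl

lemma add_eq (x y : STrop) : add x y = x + y := rfl

lemma mul_eq (x y : STrop) : mul x y = x * y := rfl

lemma elem_mul_elem (s t : SSign) (r u : ℝ) :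
    elem s r * elem t u = elem (signMul s t) (r + u) := rfl

/-- The tropical minus one `⊖0`. -/
def negOne : STrop := elem SSign.neg 0

lemma neg_eq (x : STrop) : neg x = negOne * x := by
  rcases x with _ | ⟨_ | _ | _, r⟩
  · rfl
  all_goals
    rw [negOne, elem_mul_elem, zero_add]; rfl

lemma sumFin_eq {n : ℕ} (f : Fin n → STrop) : sumFin f = ∑ j, f j := by
  induction n with
  | zero => rfl
  | succ n ih => rw [Fin.sum_univ_succ, ← ih]; rfl

lemma balZero_add {x y : STrop} (hx : balZero x) (hy : balZero y) : balZero (x + y) := by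
  rcases x with _ | ⟨_ | _ | _, r⟩ <;> rcases y with _ | ⟨_ | _ | _, u⟩ <;>
    simp only [balZero] at hx hy
  · trivial
  · trivial
  · trivial
  rw [← add_eq]
  rcases lt_trichotomy r u with h | rfl | h
  · rw [add_elem_of_lt h]; trivial
  · rw [add_elem_self]; trivial
  · rw [add_elem_of_gt h]; trivial

lemma balZero_mul (x : STrop) {y : STrop} (hy : balZero y) : balZero (x * y) := by
  rcases x with _ | ⟨_ | _ | _, r⟩ <;> rcases y with _ | ⟨_ | _ | _, u⟩ <;>
    trivial

lemma balZero_sum {ι : Type*} (s : Finset ι) {f : ι → STrop} (h : ∀ i ∈ s, balZero (f i)) :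
    balZero (∑ i ∈ s, f i) :=
  Finset.sum_induction f balZero (fun _ _ => balZero_add) trivial h

lemma nneg_add {x y : STrop} (hx : nneg x) (hy : nneg y) : nneg (x + y) := by
  rcases x with _ | ⟨_ | _ | _, r⟩ <;> rcases y with _ | ⟨_ | _ | _, u⟩ <;>
    simp only [nneg] at hx hy
  · trivial
  · trivial
  · trivial
  rw [← add_eq]
  rcases lt_trichotomy r u with h | rfl | h
  · rw [add_elem_of_lt h]; trivial
  · rw [add_elem_self]; trivial
  · rw [add_elem_of_gt h]; trivial

lemma nneg_mul {x y : STrop} (hx : nneg x) (hy : nneg y) : nneg (x * y) := by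
  rcases x with _ | ⟨_ | _ | _, r⟩ <;> rcases y with _ | ⟨_ | _ | _, u⟩ <;>
    trivial

lemma isPos_pos_mul_iff (r : ℝ) (x : STrop) : isPos (elem SSign.pos r * x) ↔ isPos x := by
  rcases x with _ | ⟨_ | _ | _, u⟩ <;> exact Iff.rfl

lemma isPos_iff {x : STrop} : isPos x ↔ ∃ r, x = elem SSign.pos r := by
  rcases x with _ | ⟨_ | _ | _, u⟩ <;> simp [isPos]

lemma sgt_zero {x : STrop} : sgt x zero ↔ isPos x := by
  rw [sgt, sub, neg, add_zero']

lemma bal_iff {x y : STrop} : bal x y ↔ balZero (x + negOne * y) := by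
  rw [bal, sub, neg_eq, add_eq]

/-- The largest real number `t` such that every signed element below `t` can be subtracted from the
given element with a strictly positive result, where `⊕r` and `⊖r` are identified
with `exp r` and `-exp r`. -/
noncomputable def lowerVal : STrop → ℝ
  | zero => 0
  | elem SSign.pos r => Real.exp r
  | elem _ r => -Real.exp r

/-- The signed element corresponding to a real number under `⊕r ↦ exp r` and `⊖r ↦ -exp r`. -/
noncomputable def ofReal (t : ℝ) : STrop :=
  if 0 < t then elem SSign.pos (Real.log t)
  else if t < 0 then elem SSign.neg (Real.log (-t))
  else zero

lemma isSigned_ofReal (t : ℝ) : isSigned (ofReal t) := by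
  unfold ofReal
  split_ifs <;> trivial

lemma lowerVal_ofReal (t : ℝ) : lowerVal (ofReal t) = t := by
  unfold ofReal
  split_ifs with h h'
  · exact Real.exp_log h
  · simp [lowerVal, -Real.log_neg_eq_log, Real.exp_log (neg_pos.2 h')]
  · simp only [lowerVal]; linarith

lemma lowerVal_ofReal_mul_negOne (t : ℝ) : lowerVal (ofReal t * elem SSign.neg 0) = -t := by
  unfold ofReal
  split_ifs with h h'
  · simp [elem_mul_elem, signMul, lowerVal, Real.exp_log h]
  · simp [elem_mul_elem, signMul, lowerVal, -Real.log_neg_eq_log, Real.exp_log (neg_pos.2 h')]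
  · rw [zero_eq, zero_mul, ← zero_eq]; simp only [lowerVal]; linarith

lemma lowerVal_ofReal_mul_bal (t : ℝ) : lowerVal (ofReal t * elem SSign.bal 0) = -|t| := by
  unfold ofReal
  split_ifs with h h'
  · simp [elem_mul_elem, signMul, lowerVal, Real.exp_log h, abs_of_pos h]
  · simp [elem_mul_elem, signMul, lowerVal, -Real.log_neg_eq_log, Real.exp_log (neg_pos.2 h'), abs_of_neg h']
  · have : t = 0 := by linarith
    rw [zero_eq, zero_mul, ← zero_eq, this]; simp [lowerVal]

lemma isPos_iff_lowerVal (x : STrop) : isPos x ↔ 0 < lowerVal x := by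
  rcases x with _ | ⟨_ | _ | _, r⟩ <;> simp [isPos, lowerVal, Real.exp_pos, (Real.exp_pos _).le]

lemma isPos_add_iff (x y : STrop) : isPos (x + y) ↔ 0 < lowerVal x + lowerVal y := by
  rcases x with _ | ⟨s, r⟩
  · rw [zero_eq, zero_add, isPos_iff_lowerVal, ← zero_eq]; simp [lowerVal]
  rcases y with _ | ⟨t, u⟩
  · rw [zero_eq, add_zero, isPos_iff_lowerVal, ← zero_eq]; simp [lowerVal]
  rw [← add_eq]
  have hr := Real.exp_pos r
  have hu := Real.exp_pos u
  rcases lt_trichotomy r u with h | rfl | h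
  · have := Real.exp_lt_exp.2 h
    rw [add_elem_of_lt h]
    cases s <;> cases t <;> simp only [isPos, lowerVal, true_iff, false_iff] <;> linarith
  · rw [add_elem_self]
    cases s <;> cases t <;> simp [isPos, lowerVal] <;> linarith
  · have := Real.exp_lt_exp.2 h
    rw [add_elem_of_gt h]
    cases s <;> cases t <;> simp only [isPos, lowerVal, true_iff, false_iff] <;> linarith

/-- The vectors that are combinations of members of `S` with nonnegative, not all zero
coefficients. -/
inductive Cone {m : ℕ} (S : Set (Fin m → STrop)) : (Fin m → STrop) → Prop
  | of {v} : v ∈ S → Cone S v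
  | add {v w} : Cone S v → Cone S w → Cone S (v + w)
  | smul (r : ℝ) {v} : Cone S v → Cone S (elem SSign.pos r • v)

lemma Cone.exists_lift {m : ℕ} {S : Set (Fin (m + 1) → STrop)} {T : Set (Fin (m + 1) → STrop)}
    (hT : ∀ w ∈ T, Cone S w ∧ balZero (w 0)) {v : Fin m → STrop} (hv : Cone (Fin.tail '' T) v) :
    ∃ w, Cone S w ∧ balZero (w 0) ∧ Fin.tail w = v := by
  induction hv with
  | of h =>
    obtain ⟨w, hw, rfl⟩ := h
    exact ⟨w, (hT w hw).1, (hT w hw).2, rfl⟩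
  | add _ _ ih₁ ih₂ =>
    obtain ⟨w₁, h₁, b₁, rfl⟩ := ih₁
    obtain ⟨w₂, h₂, b₂, rfl⟩ := ih₂
    exact ⟨w₁ + w₂, h₁.add h₂, balZero_add b₁ b₂, rfl⟩
  | smul r _ ih =>
    obtain ⟨w, h, b, rfl⟩ := ih
    exact ⟨_, h.smul r, balZero_mul _ b, rfl⟩

/-- The real number underlying the absolute value, with junk value `0` at the tropical zero. -/
def mag : STrop → ℝ
  | zero => 0
  | elem _ r => r

/-- Rescale a vector so that its first entry, if nonzero, has absolute value `0`. -/
noncomputable def normalize {m : ℕ} (s : Fin (m + 1) → STrop) : Fin (m + 1) → STrop :=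
  elem SSign.pos (-mag (s 0)) • s

lemma normalize_apply_zero {m : ℕ} {s : Fin (m + 1) → STrop} {σ : SSign} {a : ℝ}
    (h : s 0 = elem σ a) : normalize s 0 = elem σ 0 := by
  rw [normalize, Pi.smul_apply, smul_eq_mul, h, elem_mul_elem, mag, neg_add_cancel]
  rfl

lemma dotProduct_eq_cons {m : ℕ} (t : STrop) (y : Fin m → STrop) (s : Fin (m + 1) → STrop) :
    (Fin.cons t y : Fin (m + 1) → STrop) ⬝ᵥ s = t * s 0 + y ⬝ᵥ Fin.tail s := by
  simp only [dotProduct, Fin.sum_univ_succ, Fin.cons_zero, Fin.cons_succ]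
  rfl

/-- Fourier–Motzkin back substitution: a simultaneous solution of all lower bounds and upper bounds
on the eliminated variable. -/
lemma exists_isPos_cons {m : ℕ} {P M : Set (Fin (m + 1) → STrop)} (hP : P.Finite) (hM : M.Finite)
    (y : Fin m → STrop)
    (h : ∀ p ∈ P, ∀ q ∈ M, isPos (y ⬝ᵥ Fin.tail p + y ⬝ᵥ Fin.tail q)) :
    ∃ t : ℝ, (∀ p ∈ P, 0 < t + lowerVal (y ⬝ᵥ Fin.tail p)) ∧
      ∀ q ∈ M, 0 < -t + lowerVal (y ⬝ᵥ Fin.tail q) := by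
  classical
  obtain ⟨t, h₁, h₂⟩ := Order.exists_between_finsets
    (hP.toFinset.image fun p => -lowerVal (y ⬝ᵥ Fin.tail p))
    (hM.toFinset.image fun q => lowerVal (y ⬝ᵥ Fin.tail q)) (by
      simp only [Finset.mem_image, Set.Finite.mem_toFinset]
      rintro _ ⟨p, hp, rfl⟩ _ ⟨q, hq, rfl⟩
      have := (isPos_add_iff _ _).1 (h p hp q hq)
      linarith)
  simp only [Finset.mem_image, Set.Finite.mem_toFinset, forall_exists_index, and_imp,
    forall_apply_eq_imp_iff₂] at h₁ h₂
  exact ⟨t, fun p hp => by linarith [h₁ p hp], fun q hq => by linarith [h₂ q hq]⟩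

/-- Farkas' lemma over the symmetrized tropical semiring. -/
theorem exists_balZero_or_exists_isPos {m : ℕ} {S : Set (Fin m → STrop)} (hS : S.Finite) :
    (∃ v, Cone S v ∧ ∀ i, balZero (v i)) ∨
      ∃ y : Fin m → STrop, (∀ i, isSigned (y i)) ∧ ∀ s ∈ S, isPos (y ⬝ᵥ s) := by
  induction m with
  | zero =>
    rcases S.eq_empty_or_nonempty with rfl | ⟨s, hs⟩
    · exact Or.inr ⟨Fin.elim0, fun i => i.elim0, fun s hs => hs.elim⟩
    · exact Or.inl ⟨s, .of hs, fun i => i.elim0⟩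
  | succ m ih =>
    set P := normalize '' {s ∈ S | ∃ σ ≠ SSign.neg, ∃ a, s 0 = elem σ a}
    set M := normalize '' {s ∈ S | ∃ σ ≠ SSign.pos, ∃ a, s 0 = elem σ a}
    set Z := {s ∈ S | s 0 = 0}
    have fP : P.Finite := (hS.sep _).image _
    have fM : M.Finite := (hS.sep _).image _
    have fT : (Z ∪ Set.image2 (· + ·) P M).Finite := (hS.sep _).union (fP.image2 _ fM)
    rcases ih (fT.image Fin.tail) with ⟨v, hv, hb⟩ | ⟨y, hy, hpos⟩
    · left
      obtain ⟨w, hw, hw0, rfl⟩ := hv.exists_lift (S := S) (by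
        rintro w (⟨hw, hw0⟩ | ⟨_, ⟨p, ⟨hp, σ, hσ, a, hpa⟩, rfl⟩, _, ⟨q, ⟨hq, τ, hτ, b, hqb⟩, rfl⟩,
          rfl⟩)
        · exact ⟨.of hw, by rw [hw0]; trivial⟩
        · refine ⟨((Cone.of hp).smul _).add ((Cone.of hq).smul _), ?_⟩
          change balZero (normalize p 0 + normalize q 0)
          rw [normalize_apply_zero hpa, normalize_apply_zero hqb, ← add_eq,
            add_elem_self]
          cases σ <;> cases τ <;> trivial)
      exact ⟨w, hw, fun i => Fin.cases hw0 hb i⟩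
    · right
      obtain ⟨t, ht₁, ht₂⟩ := exists_isPos_cons fP fM y (fun p hp q hq => by
        rw [← dotProduct_add]
        exact hpos _ ⟨p + q, Or.inr ⟨p, hp, q, hq, rfl⟩, rfl⟩)
      refine ⟨Fin.cons (ofReal t) y, fun i => Fin.cases (isSigned_ofReal t) hy i, fun s hs => ?_⟩
      rcases hs0 : s 0 with _ | ⟨σ, a⟩
      · rw [dotProduct_eq_cons, hs0, zero_eq, mul_zero, zero_add]
        exact hpos _ ⟨s, Or.inl ⟨hs, hs0⟩, rfl⟩
      · rw [← isPos_pos_mul_iff (-mag (s 0)), ← smul_eq_mul, ← dotProduct_smul]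
        change isPos (_ ⬝ᵥ normalize s)
        rw [dotProduct_eq_cons, normalize_apply_zero hs0, isPos_add_iff]
        have h₁ : σ ≠ SSign.neg → _ := fun h => ht₁ _ ⟨s, ⟨hs, σ, h, a, hs0⟩, rfl⟩
        have h₂ : σ ≠ SSign.pos → _ := fun h => ht₂ _ ⟨s, ⟨hs, σ, h, a, hs0⟩, rfl⟩
        cases σ with
        | pos =>
          rw [← one, one_eq, mul_one, lowerVal_ofReal]
          exact h₁ (by simp)
        | neg =>
          rw [lowerVal_ofReal_mul_negOne]
          exact h₂ (by simp)
        | bal =>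
          rw [lowerVal_ofReal_mul_bal]
          have h₁ := h₁ (by simp)
          have h₂ := h₂ (by simp)
          rcases abs_cases t with ⟨h, -⟩ | ⟨h, -⟩ <;> rw [h] <;> linarith

lemma eq_zero_of_add_eq_zero {x y : STrop} (h : x + y = 0) : x = 0 := by
  rcases x with _ | ⟨s, r⟩
  · rfl
  rcases y with _ | ⟨t, u⟩
  · exact absurd h STrop.noConfusion
  rw [← add_eq] at h
  rcases lt_trichotomy r u with h' | rfl | h'
  · rw [add_elem_of_lt h'] at h; exact absurd h STrop.noConfusion
  · rw [add_elem_self] at h; exact absurd h STrop.noConfusion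
  · rw [add_elem_of_gt h'] at h; exact absurd h STrop.noConfusion

lemma eq_zero_of_elem_mul_eq_zero {s : SSign} {r : ℝ} {x : STrop} (h : elem s r * x = 0) :
    x = 0 := by
  rcases x with _ | ⟨t, u⟩
  · rfl
  · exact absurd h STrop.noConfusion

lemma Cone.exists_coeff {m n : ℕ} {c : Fin n → Fin m → STrop} {v : Fin m → STrop}
    (hv : Cone (Set.range c) v) :
    ∃ x : Fin n → STrop, (∀ j, nneg (x j)) ∧ (∃ j, x j ≠ 0) ∧ ∀ i, v i = ∑ j, c j i * x j := by
  induction hv with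
  | of h =>
    obtain ⟨j, rfl⟩ := h
    refine ⟨Pi.single j 1, fun k => ?_, ⟨j, ?_⟩, fun i => ?_⟩
    · by_cases h : k = j
      · subst h; rw [Pi.single_eq_same]; trivial
      · rw [Pi.single_eq_of_ne h]; trivial
    · rw [Pi.single_eq_same]
      exact STrop.noConfusion
    · rw [Finset.sum_eq_single j]
      · rw [Pi.single_eq_same, mul_one]
      · intro k _ hk
        rw [Pi.single_eq_of_ne hk, mul_zero]
      · simp
  | add _ _ ih₁ ih₂ =>
    obtain ⟨x, hx, ⟨j, hj⟩, hxv⟩ := ih₁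
    obtain ⟨y, hy, -, hyv⟩ := ih₂
    refine ⟨x + y, fun k => nneg_add (hx k) (hy k), ⟨j, fun h => hj ?_⟩, fun i => ?_⟩
    · exact eq_zero_of_add_eq_zero h
    · simp only [Pi.add_apply, hxv, hyv, mul_add, Finset.sum_add_distrib]
  | smul r _ ih =>
    obtain ⟨x, hx, ⟨j, hj⟩, hxv⟩ := ih
    refine ⟨elem SSign.pos r • x, fun k => nneg_mul (x := elem _ r) trivial (hx k),
      ⟨j, fun h => hj ?_⟩, fun i => ?_⟩
    · exact eq_zero_of_elem_mul_eq_zero h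
    · simp only [Pi.smul_apply, hxv, smul_eq_mul, Finset.mul_sum, mul_left_comm]

/-- `x` is a nonzero element of absolute value `r` that is not strictly positive. -/
def NotPosAt (r : ℝ) (x : STrop) : Prop := ∃ s ≠ SSign.pos, x = elem s r

lemma NotPosAt.of_add {r : ℝ} {x y : STrop} (h : NotPosAt r (x + y)) :
    NotPosAt r x ∨ NotPosAt r y := by
  rcases x with _ | ⟨s, a⟩
  · exact Or.inr h
  rcases y with _ | ⟨t, b⟩
  · exact Or.inl h
  rw [← add_eq] at h
  rcases lt_trichotomy a b with h' | rfl | h'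
  · rw [add_elem_of_lt h'] at h
    exact Or.inr h
  · rw [add_elem_self] at h
    obtain ⟨w, hw, hr⟩ := h
    simp only [elem.injEq] at hr
    obtain ⟨hs, rfl⟩ := hr
    by_cases hsp : s = SSign.pos
    · refine Or.inr ⟨t, ?_, rfl⟩
      rintro rfl
      subst hsp
      exact hw hs.symm
    · exact Or.inl ⟨s, hsp, rfl⟩
  · rw [add_elem_of_gt h'] at h
    exact Or.inl h

lemma NotPosAt.of_sum {ι : Type*} {s : Finset ι} {f : ι → STrop} {r : ℝ}
    (h : NotPosAt r (∑ i ∈ s, f i)) : ∃ i ∈ s, NotPosAt r (f i) := by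
  by_contra! hf
  exact Finset.sum_induction f (fun x => ¬ NotPosAt r x)
    (fun _ _ hx hy hxy => hxy.of_add.elim hx hy)
    (fun ⟨_, _, h⟩ => STrop.noConfusion h) hf h

lemma NotPosAt.lt_of_isPos_add {r : ℝ} {x y : STrop} (hx : NotPosAt r x) (h : isPos (x + y)) :
    ∃ q, r < q ∧ x + y = elem SSign.pos q := by
  obtain ⟨s, hs, rfl⟩ := hx
  rw [isPos_add_iff] at h
  have hr := Real.exp_pos r
  have hl : lowerVal (elem s r) = -Real.exp r := by
    cases s <;> first | rfl | contradiction
  rw [hl] at h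
  obtain ⟨q, rfl⟩ := isPos_iff.1 ((isPos_iff_lowerVal y).2 (by linarith))
  simp only [lowerVal] at h
  have hrq : r < q := Real.exp_lt_exp.1 (by linarith)
  exact ⟨q, hrq, add_elem_of_lt hrq⟩

lemma le_of_pos_add_eq {q ρ : ℝ} {y : STrop} (hy : nneg y)
    (h : elem SSign.pos q + y = elem SSign.pos ρ) : q ≤ ρ := by
  rw [← add_eq] at h
  rcases y with _ | ⟨_ | _ | _, u⟩ <;> simp only [nneg] at hy
  · rw [add_zero'] at h
    exact (elem.inj h).2.le
  · rcases lt_trichotomy q u with h' | rfl | h'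
    · rw [add_elem_of_lt h'] at h
      exact h'.le.trans (elem.inj h).2.le
    · rw [add_elem_self] at h
      exact (elem.inj h).2.le
    · rw [add_elem_of_gt h'] at h
      exact (elem.inj h).2.le

lemma negOne_mul_elem (s : SSign) (r : ℝ) :
    negOne * elem s r = elem (signMul SSign.neg s) r := by
  rw [negOne, elem_mul_elem, zero_add]

lemma exists_notPosAt_of_balZero_sub_pos {ρ : ℝ} {w : STrop} (hw : ¬ isPos w)
    (h : balZero (w + negOne * elem SSign.pos ρ)) : ∃ W, ρ ≤ W ∧ NotPosAt W w := by
  rw [negOne_mul_elem, ← add_eq] at h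
  rcases w with _ | ⟨s, W⟩
  · exact h.elim
  refine ⟨W, le_of_not_gt fun hlt => ?_, s, ?_, rfl⟩
  · rw [add_elem_of_lt hlt] at h
    exact h
  · rintro rfl
    exact hw trivial

lemma exists_notPosAt_of_balZero_neg_sub {W : ℝ} {y : STrop}
    (h : balZero (elem SSign.neg W + negOne * y)) : ∃ V, W ≤ V ∧ NotPosAt V y := by
  rcases y with _ | ⟨s, V⟩
  · exact h.elim
  rw [negOne_mul_elem, ← add_eq] at h
  refine ⟨V, le_of_not_gt fun hlt => ?_, s, ?_, rfl⟩
  · rw [add_elem_of_gt hlt] at h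
    exact h
  · rintro rfl
    rcases lt_trichotomy W V with h' | rfl | h'
    · rw [add_elem_of_lt h'] at h
      exact h
    · rw [add_elem_self] at h
      exact h
    · rw [add_elem_of_gt h'] at h
      exact h

lemma eq_zero_or_eq_pos {x : STrop} (hx : nneg x) : x = 0 ∨ ∃ r, x = elem SSign.pos r := by
  rcases x with _ | ⟨_ | _ | _, r⟩
  · exact Or.inl rfl
  · exact Or.inr ⟨r, rfl⟩
  · exact hx.elim
  · exact hx.elim

lemma isSigned_mul {x y : STrop} (hx : isSigned x) (hy : isSigned y) : isSigned (x * y) := by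
  rcases x with _ | ⟨_ | _ | _, r⟩ <;> rcases y with _ | ⟨_ | _ | _, u⟩ <;> trivial

lemma nneg_of_isPos {x : STrop} (h : isPos x) : nneg x := by
  obtain ⟨r, rfl⟩ := isPos_iff.1 h
  trivial

lemma nneg_sum {ι : Type*} (s : Finset ι) {f : ι → STrop} (h : ∀ i ∈ s, nneg (f i)) :
    nneg (∑ i ∈ s, f i) :=
  Finset.sum_induction f nneg (fun _ _ => nneg_add) trivial h

/-- A signed functional that is strictly positive on a family of vectors is strictly positive on
every signed vector balancing a nontrivial nonnegative combination of the family. -/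
lemma isPos_dotProduct_of_balZero {m n : ℕ} {B : Fin n → Fin m → STrop} {x : Fin n → STrop}
    {v z : Fin m → STrop} (hx : ∀ j, nneg (x j)) (hx0 : ∃ j, x j ≠ 0)
    (hz : ∀ i, isSigned (z i)) (hv : ∀ i, isSigned (v i)) (hB : ∀ j, isPos (v ⬝ᵥ B j))
    (hbal : ∀ i, balZero (z i + negOne * ∑ j, B j i * x j)) : isPos (v ⬝ᵥ z) := by
  by_contra hneg
  have hterm : ∀ j, nneg (x j * (v ⬝ᵥ B j)) := fun j => nneg_mul (hx j) (nneg_of_isPos (hB j))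
  obtain ⟨ρ, hρ⟩ : ∃ ρ, ∑ j, x j * (v ⬝ᵥ B j) = elem SSign.pos ρ := by
    refine (eq_zero_or_eq_pos (nneg_sum _ fun j _ => hterm j)).resolve_left fun h => ?_
    obtain ⟨j, hj⟩ := hx0
    rw [← Finset.add_sum_erase _ _ (Finset.mem_univ j)] at h
    obtain ⟨q, hq⟩ := isPos_iff.1 (hB j)
    have h := eq_zero_of_add_eq_zero h
    rw [hq, mul_comm] at h
    exact hj (eq_zero_of_elem_mul_eq_zero h)
  have hswap : ∑ i, v i * ∑ j, B j i * x j = ∑ j, x j * (v ⬝ᵥ B j) := by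
    simp only [dotProduct, Finset.mul_sum]
    rw [Finset.sum_comm]
    exact Finset.sum_congr rfl fun j _ => Finset.sum_congr rfl fun i _ => by ring
  have htot : balZero (v ⬝ᵥ z + negOne * elem SSign.pos ρ) := by
    rw [← hρ, ← hswap, dotProduct, Finset.mul_sum, ← Finset.sum_add_distrib]
    refine balZero_sum _ fun i _ => ?_
    rw [mul_left_comm, ← mul_add]
    exact balZero_mul _ (hbal i)
  obtain ⟨W, hρW, hW⟩ := exists_notPosAt_of_balZero_sub_pos hneg htot
  obtain ⟨k, -, s, hs, hk⟩ := hW.of_sum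
  have hsneg : s = SSign.neg := by
    have := isSigned_mul (hv k) (hz k)
    rw [hk] at this
    cases s
    · contradiction
    · rfl
    · exact this.elim
  subst hsneg
  have hkbal := balZero_mul (v k) (hbal k)
  rw [mul_add, hk, mul_left_comm] at hkbal
  obtain ⟨V, hWV, hV⟩ := exists_notPosAt_of_balZero_neg_sub hkbal
  rw [Finset.mul_sum] at hV
  obtain ⟨j, -, hj⟩ := hV.of_sum
  have hxj : ∃ r, x j = elem SSign.pos r := by
    refine (eq_zero_or_eq_pos (hx j)).resolve_left fun h => ?_
    rw [h, mul_zero, mul_zero] at hj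
    obtain ⟨_, _, h⟩ := hj
    exact STrop.noConfusion h
  have hpos : isPos (x j * (v ⬝ᵥ B j)) := by
    obtain ⟨r, hr⟩ := hxj
    rw [hr, isPos_pos_mul_iff]
    exact hB j
  have hsplit : x j * (v ⬝ᵥ B j) =
      v k * (B j k * x j) + x j * ∑ i ∈ Finset.univ.erase k, v i * B j i := by
    rw [dotProduct, ← Finset.add_sum_erase _ _ (Finset.mem_univ k)]
    ring
  rw [hsplit] at hpos
  obtain ⟨q, hVq, hq⟩ := hj.lt_of_isPos_add hpos
  rw [← hsplit] at hq
  rw [← Finset.add_sum_erase _ _ (Finset.mem_univ j), hq] at hρ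
  have := le_of_pos_add_eq (nneg_sum _ fun j _ => hterm j) hρ
  linarith

lemma balZero_one_sub_iff {y : STrop} (hy : nneg y) : balZero (1 + negOne * y) ↔ y = 1 := by
  constructor
  · intro h
    rcases eq_zero_or_eq_pos hy with rfl | ⟨r, rfl⟩
    · rw [mul_zero, add_zero] at h
      exact h.elim
    rw [negOne_mul_elem, ← one_eq, one, ← add_eq] at h
    rcases lt_trichotomy 0 r with h' | rfl | h'
    · rw [add_elem_of_lt h'] at h
      exact h.elim
    · rfl
    · rw [add_elem_of_gt h'] at h
      exact h.elim
  · rintro rfl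
    rw [mul_one, ← one_eq, one, negOne, ← add_eq, add_elem_self]
    trivial

lemma affEval_eq {d : ℕ} (v : Fin (d + 1) → STrop) (x : Fin d → STrop) :
    affEval v x = v ⬝ᵥ (Fin.cons 1 x : Fin (d + 1) → STrop) :=
  sumFin_eq _

/-- Membership in the signed convex hull in homogeneous coordinates. -/
lemma mem_tconv_iff {d n : ℕ} {A : Fin d → Fin n → STrop} {z : Fin d → STrop} :
    z ∈ tconv A ↔ isSignedVec z ∧ ∃ x : Fin n → STrop, (∀ j, nneg (x j)) ∧
      ∀ i : Fin (d + 1), balZero ((Fin.cons 1 z : Fin (d + 1) → STrop) i +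
        negOne * ∑ j, (Fin.cons 1 (fun k => A k j) : Fin (d + 1) → STrop) i * x j) := by
  simp only [tconv, Set.mem_ofPred_eq, Fin.forall_fin_succ, Fin.cons_zero, Fin.cons_succ, one_mul,
    bal_iff, mv, sumFin_eq, mul_eq, one_eq]
  refine and_congr_right fun _ => exists_congr fun x => and_congr_right fun hx => ?_
  rw [balZero_one_sub_iff (nneg_sum _ fun j _ => hx j)]

lemma isSigned_cons_one {d : ℕ} {z : Fin d → STrop} (hz : ∀ i, isSigned (z i)) (i : Fin (d + 1)) :
    isSigned ((Fin.cons 1 z : Fin (d + 1) → STrop) i) :=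
  Fin.cases trivial hz i

lemma tconv_subset_Hopen {d n : ℕ} {A : Fin d → Fin n → STrop} {v : Fin (d + 1) → STrop}
    (hv : ∀ k, isSigned (v k)) (hA : ∀ j, (fun i => A i j) ∈ Hopen v) : tconv A ⊆ Hopen v := by
  intro z hz
  obtain ⟨hzs, x, hx, hbal⟩ := mem_tconv_iff.1 hz
  refine ⟨hzs, sgt_zero.2 ?_⟩
  rw [affEval_eq]
  refine isPos_dotProduct_of_balZero hx ?_ (isSigned_cons_one hzs) hv (fun j => ?_) hbal
  · by_contra! h
    have := hbal 0
    simp only [h, mul_zero, Finset.sum_const_zero, add_zero, Fin.cons_zero] at this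
    exact this
  · rw [← affEval_eq]
    exact sgt_zero.1 (hA j).2

lemma negOne_mul_negOne : negOne * negOne = 1 := by
  rw [negOne, elem_mul_elem, add_zero]
  rfl

lemma mem_tconv_of_forall_Hopen {d n : ℕ} {A : Fin d → Fin n → STrop}
    (hA : ∀ i j, isSigned (A i j)) {z : Fin d → STrop}
    (h : ∀ v : Fin (d + 1) → STrop, (∀ k, isSigned (v k)) →
      (∀ j, (fun i => A i j) ∈ Hopen v) → z ∈ Hopen v) : z ∈ tconv A := by
  have hz : isSignedVec z := by
    have hpos (x : Fin d → STrop) : affEval (Fin.cons 1 0) x = 1 := by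
      rw [affEval_eq, dotProduct_eq_cons, zero_dotProduct, add_zero, Fin.cons_zero, mul_one]
    refine (h (Fin.cons 1 0) (isSigned_cons_one fun _ => trivial) fun j =>
      ⟨fun i => hA i j, sgt_zero.2 ?_⟩).1
    rw [hpos]
    trivial
  set z' : Fin (d + 1) → STrop := Fin.cons 1 z with hz'
  set B : Fin n → Fin (d + 1) → STrop := fun j => Fin.cons 1 fun k => A k j with hB
  let c : Fin (n + 1) → Fin (d + 1) → STrop := Fin.cons (negOne • z') B
  rcases exists_balZero_or_exists_isPos (Set.finite_range c) with ⟨v, hv, hb⟩ | ⟨y, hy, hpos⟩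
  · obtain ⟨x, hx, ⟨j, hj⟩, hxv⟩ := hv.exists_coeff
    have hb' (i : Fin (d + 1)) :
        balZero (negOne * z' i * x 0 + ∑ j : Fin n, B j i * x j.succ) := by
      have hbi := hb i
      rw [hxv, Fin.sum_univ_succ] at hbi
      exact hbi
    rcases eq_zero_or_eq_pos (hx 0) with h0 | ⟨r, hr⟩
    · exfalso
      have hb0 := hb' 0
      simp only [h0, mul_zero, zero_add, hB, Fin.cons_zero, one_mul] at hb0
      have hsum : ∑ j : Fin n, x j.succ = 0 := by
        rcases eq_zero_or_eq_pos (nneg_sum Finset.univ fun j _ => hx (Fin.succ j)) with h | ⟨r, h⟩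
        · exact h
        · rw [h] at hb0
          exact hb0.elim
      induction j using Fin.cases with
      | zero => exact hj h0
      | succ j =>
        rw [← Finset.add_sum_erase _ _ (Finset.mem_univ j)] at hsum
        exact hj (eq_zero_of_add_eq_zero hsum)
    · refine mem_tconv_iff.2 ⟨hz, fun j => elem SSign.pos (-r) * x j.succ,
        fun j => nneg_mul (x := elem _ (-r)) trivial (hx _), fun i => ?_⟩
      have hinv : elem SSign.pos (-r) * elem SSign.pos r = 1 := by
        rw [elem_mul_elem, neg_add_cancel]
        rfl
      have key := balZero_mul (negOne * elem SSign.pos (-r)) (hb' i)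
      convert key using 1
      have h₁ : negOne * elem SSign.pos (-r) * (negOne * z' i * x 0) = z' i := by
        calc _ = (negOne * negOne) * (elem SSign.pos (-r) * elem SSign.pos r) * z' i := by
              rw [hr]; ring
          _ = z' i := by rw [negOne_mul_negOne, hinv, one_mul, one_mul]
      rw [mul_add, h₁, mul_assoc, Finset.mul_sum (a := elem SSign.pos (-r))]
      simp only [mul_left_comm, hB, hz']
  · exfalso
    have hmem := (h y hy fun j => ⟨fun i => hA i j, sgt_zero.2 (by
      rw [affEval_eq]
      exact hpos (B j) ⟨j.succ, rfl⟩)⟩).2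
    rw [sgt_zero, affEval_eq] at hmem
    have hneg := hpos (negOne • z') ⟨0, rfl⟩
    rw [dotProduct_smul, smul_eq_mul] at hneg
    obtain ⟨r, hr⟩ := isPos_iff.1 hmem
    rw [hr, negOne_mul_elem] at hneg
    exact hneg

end STrop

/-- the inner hull tconv(A) equals the intersection of all open
signed tropical halfspaces containing the columns of A. -/
theorem outer_hull_eq_inner_hull (d n : ℕ) (A : Fin d → Fin n → STrop)
    (hA : ∀ i j, STrop.isSigned (A i j)) :
    STrop.tconv A =
      ⋂ (v : Fin (d + 1) → STrop)
        (_ : (∀ k, STrop.isSigned (v k)) ∧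
          ∀ j : Fin n, (fun i => A i j) ∈ STrop.Hopen v),
        STrop.Hopen v := by
  refine Set.Subset.antisymm (Set.subset_iInter₂ fun v hv => ?_) fun z hz => ?_
  · exact STrop.tconv_subset_Hopen hv.1 hv.2
  · exact STrop.mem_tconv_of_forall_Hopen hA fun v hv hAv => Set.mem_iInter₂.1 hz v ⟨hv, hAv⟩
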